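/- Let G and H be abelian groups, let π : G → H be a surjective group homomorphism whose kernel is infinite, and let l ≥ 1 be an integer such that the set {x ∈ G : l·x = 0} of l-torsion elements of G is finite. Let g ∈ G and h ∈ H be such that h − π(g) ∈ lH. Then the set {e ∈ G : π(e) = h and e − g ∈ lG} is infinite. -/

import Mathlib

/-- Let `π : G → H` be a surjective homomorphism of abelian groups with infinite kernel,
and `l ≥ 1` such that the `l`-torsion of `G` is finite.  If `g ∈ G` and `h ∈ H` satisfy
`h - π g ∈ l·H`, then `{e ∈ G : π e = h and e - g ∈ l·G}` is infinite. -/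
theorem infinite_fiber_with_divisibility {G H : Type*} [AddCommGroup G] [AddCommGroup H]
    (π : G →+ H) (hsurj : Function.Surjective π)
    (hker : {x : G | π x = 0}.Infinite)
    (l : ℕ) (hl : 1 ≤ l) (htor : {x : G | l • x = 0}.Finite)
    (g : G) (h : H) (hdiv : ∃ y : H, h - π g = l • y) :
    {e : G | π e = h ∧ ∃ y : G, e - g = l • y}.Infinite := by
  obtain ⟨y, hy⟩ := hdiv
  obtain ⟨z, rfl⟩ := hsurj y
  intro hfin
  have hfib (b : G) : ((fun k : G => g + l • (z + k)) ⁻¹' {b}).Finite := by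
    rcases Set.eq_empty_or_nonempty ((fun k : G => g + l • (z + k)) ⁻¹' {b}) with hb | ⟨k₀, hk₀⟩
    · exact hb ▸ Set.finite_empty
    · refine (htor.image (fun t => k₀ + t)).subset fun k hk => ⟨k - k₀, ?_, by simp⟩
      have hkk : g + l • (z + k) = g + l • (z + k₀) := hk.trans hk₀.symm
      simpa [smul_add, smul_sub, sub_eq_zero] using hkk
  refine hker ((hfin.preimage' fun b _ => hfib b).subset fun k hk => ⟨?_, z + k, by simp⟩)
  have hk' : π k = 0 := hk
  simp [hk', ← hy]
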